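/- F(x) > 0 for every real x > 0. -/

import Mathlib

open Filter Real

/-- `Q j = ∏_{ℓ=1}^{j} (1 - 2^{-ℓ})`. -/
noncomputable def Q (j : ℕ) : ℝ := ∏ l ∈ Finset.range j, (1 - (2:ℝ)^(-(l:ℤ)-1))

/-- `Q_∞ = ∏_{ℓ≥1} (1 - 2^{-ℓ})`. -/
noncomputable def Qinf : ℝ := ∏' l : ℕ, (1 - (2:ℝ)^(-(l:ℤ)-1))

/-- `F(x) = ∑_{j≥0} (-1)^j 2^{-j(j-1)/2} e^{-2^j x} / (Q_j Q_∞)`. -/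
noncomputable def F (x : ℝ) : ℝ :=
  ∑' j : ℕ, (-1:ℝ)^j * ((2:ℝ)^(j.choose 2))⁻¹ * Real.exp (-(2:ℝ)^j * x) / (Q j * Qinf)

lemma qz (l : ℕ) : (2:ℝ)^(-(l:ℤ)-1) = (1/2)^(l+1) := by
  have : (-(l:ℤ)-1) = -((l+1 : ℕ):ℤ) := by push_cast; ring
  rw [this, zpow_neg, zpow_natCast, one_div, inv_pow]

lemma Q_zero : Q 0 = 1 := by simp [Q]

lemma Q_succ (j : ℕ) : Q (j+1) = Q j * (1 - (1/2)^(j+1)) := by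
  rw [Q, Finset.prod_range_succ, qz, Q]

lemma Q_lower (j : ℕ) : 1/4 + (1/2:ℝ)^(j+2) ≤ Q (j+1) := by
  induction j with
  | zero => rw [Q_succ, Q_zero]; norm_num
  | succ k ih =>
    rw [Q_succ (k+1)]
    have h1 : (1/2:ℝ)^(k+2) ≤ (1/2)^2 := pow_le_pow_of_le_one (by norm_num) (by norm_num) (by omega)
    have h0 : (0:ℝ) < (1/2:ℝ)^(k+2) := by positivity
    have e : (1/2:ℝ)^(k+1+2) = (1/2)^(k+2) * (1/2) := by ring
    have e' : (1/2:ℝ)^(k+1+1) = (1/2)^(k+2) := by ring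
    rw [e, e']
    set u := (1/2:ℝ)^(k+2)
    nlinarith

lemma Q_ge (j : ℕ) : 1/4 ≤ Q j := by
  cases j with
  | zero => rw [Q_zero]; norm_num
  | succ k =>
    have := Q_lower k
    have h0 : (0:ℝ) < (1/2:ℝ)^(k+2) := by positivity
    linarith

lemma Q_pos (j : ℕ) : 0 < Q j := by linarith [Q_ge j]

lemma Q_tendsto : Tendsto Q atTop (nhds Qinf) := by
  have hm : Multipliable (fun l : ℕ => (1 - (2:ℝ)^(-(l:ℤ)-1))) := by
    have hs : Summable (fun l : ℕ => -(2:ℝ)^(-(l:ℤ)-1)) := by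
      apply Summable.neg
      simp_rw [qz]
      exact (summable_nat_add_iff 1).2 (summable_geometric_of_lt_one (by norm_num) (by norm_num))
    simpa [sub_eq_add_neg] using Real.multipliable_one_add_of_summable hs
  exact hm.hasProd.tendsto_prod_nat

lemma Qinf_ge : 1/4 ≤ Qinf := ge_of_tendsto' Q_tendsto Q_ge

lemma Qinf_pos : 0 < Qinf := by linarith [Qinf_ge]

noncomputable def aa (j : ℕ) : ℝ := (-1:ℝ)^j * ((2:ℝ)^(j.choose 2))⁻¹ / Q j

noncomputable def ff (n : ℕ) (x : ℝ) : ℝ :=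
  ∑ j ∈ Finset.range (n+1), aa j * Real.exp (-(2:ℝ)^j * x) / Q (n - j)

lemma aa_succ (j : ℕ) : aa (j+1) * (1 - (1/2)^(j+1)) = - (1/2)^j * aa j := by
  have h := Q_succ j
  have hp := Q_pos j
  have hp' := Q_pos (j+1)
  have hr : (1 - (1/2:ℝ)^(j+1)) ≠ 0 := by
    intro h0
    rw [h0] at h
    linarith
  have hc : (j+1).choose 2 = j + j.choose 2 := by
    rw [Nat.choose_succ_succ' j 1]; simp
  unfold aa
  rw [h, hc, pow_add, pow_succ]
  generalize (1 - (1/2:ℝ)^(j+1)) = r at hr ⊢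
  rw [one_div, inv_pow]
  field_simp
  rw [pow_add]

lemma aa_succ' (j : ℕ) : aa (j+1) * (1 - 2^(j+1)) = 2 * aa j := by
  have h := aa_succ j
  have e : (1/2:ℝ)^(j+1) * 2^(j+1) = 1 := by rw [← mul_pow]; norm_num
  have e2 : (1/2:ℝ)^(j) * 2^(j) = 1 := by rw [← mul_pow]; norm_num
  have : aa (j+1) * (1 - 2^(j+1)) = -(aa (j+1) * (1 - (1/2)^(j+1))) * 2^(j+1) := by
    linear_combination (-aa (j+1)) * e
  rw [this, h]
  linear_combination (2 * aa j) * e2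

lemma S_rec (n : ℕ) : (1 - (1/2)^(n+1)) * ff (n+1) 0 = (1 - (1/2)^n) * ff n 0 := by
  have key : ∀ j ∈ Finset.range (n+2), (1 - (1/2:ℝ)^(n+1)) * (aa j / Q (n+1-j))
      = aa j * (1 - (1/2)^(n+1-j)) / Q (n+1-j)
        + (1/2)^(n+1-j) * (aa j * (1 - (1/2)^j)) / Q (n+1-j) := by
    intro j hj
    have hj' : j ≤ n+1 := by simp at hj; omega
    have : (1/2:ℝ)^(n+1) = (1/2)^(n+1-j) * (1/2)^j := by rw [← pow_add]; congr 1; omega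
    rw [this]; ring
  simp only [ff, mul_zero, Real.exp_zero, mul_one]
  rw [Finset.mul_sum, Finset.sum_congr rfl key, Finset.sum_add_distrib,
    Finset.sum_range_succ, Finset.sum_range_succ' (fun j => (1/2:ℝ)^(n+1-j) * (aa j * (1 - (1/2)^j)) / Q (n+1-j))]
  simp only [Nat.sub_self, pow_zero, sub_self, mul_zero, zero_div, add_zero]
  rw [← Finset.sum_add_distrib, Finset.mul_sum]
  apply Finset.sum_congr rfl
  intro j hj
  have hj' : j ≤ n := by simp at hj; omega
  obtain ⟨k, rfl⟩ := Nat.exists_eq_add_of_le hj'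
  have e1 : j + k + 1 - j = k + 1 := by omega
  have e2 : j + k + 1 - (j+1) = k := by omega
  have e3 : j + k - j = k := by omega
  rw [e1, e2, e3, aa_succ, Q_succ k]
  have hr : (1 - (1/2:ℝ)^(k+1)) ≠ 0 := by
    intro h0
    have h := Q_succ k
    rw [h0] at h
    linarith [Q_pos (k+1)]
  rw [mul_div_mul_right _ _ hr, pow_add]
  ring

lemma ff_zero_arg (n : ℕ) : ff (n+1) 0 = 0 := by
  have hr : ∀ k : ℕ, (1 - (1/2:ℝ)^(k+1)) ≠ 0 := by
    intro k h0
    have h := Q_succ k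
    rw [h0] at h
    linarith [Q_pos (k+1)]
  induction n with
  | zero =>
    have := S_rec 0
    rw [pow_zero, sub_self, zero_mul] at this
    exact (mul_eq_zero.1 this).resolve_left (hr 0)
  | succ n ih =>
    have := S_rec (n+1)
    rw [ih, mul_zero] at this
    exact (mul_eq_zero.1 this).resolve_left (hr (n+1))

noncomputable def hh (n : ℕ) (x : ℝ) : ℝ := Real.exp x * ff n x

lemma ff_deriv (n : ℕ) (x : ℝ) :
    HasDerivAt (ff (n+1)) (2 * ff n (2*x) - ff (n+1) x) x := by
  have h : HasDerivAt (ff (n+1)) (∑ j ∈ Finset.range (n+2),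
      aa j * (Real.exp (-(2:ℝ)^j * x) * (-(2:ℝ)^j)) / Q (n+1-j)) x := by
    unfold ff
    apply HasDerivAt.fun_sum
    intro j _
    apply HasDerivAt.div_const
    apply HasDerivAt.const_mul
    apply HasDerivAt.exp
    have h1 := (hasDerivAt_id x).const_mul (-(2:ℝ)^j)
    rw [mul_one] at h1
    exact h1
  refine HasDerivAt.congr_deriv h ?_
  symm
  rw [sub_eq_iff_eq_add]
  unfold ff
  rw [← Finset.sum_add_distrib, Finset.mul_sum, Finset.sum_range_succ' _ (n+1)]
  simp only [pow_zero]
  have : ∀ a b : ℝ, a = b → ∀ c : ℝ, c = 0 → a = b + c := by intros; linarith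
  apply this
  · apply Finset.sum_congr rfl
    intro j hj
    have e2 : n + 1 - (j+1) = n - j := by omega
    have e3 : -(2:ℝ)^(j+1) * x = -(2:ℝ)^j * (2*x) := by ring
    rw [e2, e3]
    linear_combination (-(Real.exp (-(2:ℝ)^j * (2*x)) / Q (n-j))) * aa_succ' j
  · ring

lemma hh_deriv (n : ℕ) (x : ℝ) :
    HasDerivAt (hh (n+1)) (2 * Real.exp (-x) * hh n (2*x)) x := by
  have h := (Real.hasDerivAt_exp x).mul (ff_deriv n x)
  refine HasDerivAt.congr_deriv h ?_
  unfold hh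
  have : Real.exp (2*x) = Real.exp x * Real.exp x := by rw [← Real.exp_add]; ring_nf
  rw [this, Real.exp_neg]
  field_simp
  ring

lemma hh_mono (n : ℕ) : 0 ≤ hh n 0 ∧ MonotoneOn (hh n) (Set.Ici 0) := by
  induction n with
  | zero =>
    have : ∀ x, hh 0 x = 1 := by
      intro x
      simp [hh, ff, aa, Q_zero, ← Real.exp_add]
    constructor
    · rw [this]; norm_num
    · intro a _ b _ _
      rw [this, this]
  | succ n ih =>
    constructor
    · simp [hh, ff_zero_arg]
    · apply monotoneOn_of_deriv_nonneg (convex_Ici 0)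
      · exact fun x _ => (hh_deriv n x).continuousAt.continuousWithinAt
      · exact fun x _ => (hh_deriv n x).differentiableAt.differentiableWithinAt
      · intro x hx
        rw [interior_Ici, Set.mem_Ioi] at hx
        rw [(hh_deriv n x).deriv]
        have h1 : hh n 0 ≤ hh n (2*x) :=
          ih.2 (by simp) (by simp; linarith) (by linarith)
        have h2 : 0 ≤ hh n (2*x) := ih.1.trans h1
        positivity

lemma hh_nonneg (n : ℕ) {x : ℝ} (hx : 0 ≤ x) : 0 ≤ hh n x :=
  (hh_mono n).1.trans ((hh_mono n).2 (by simp) hx hx)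

lemma hh_step (n : ℕ) {x : ℝ} (hx : 0 < x) :
    2 * Real.exp (-x) * hh n (3/2*x) * (x/4) ≤ hh (n+1) x := by
  obtain ⟨c, hc, h⟩ := exists_hasDerivAt_eq_slope (hh (n+1))
    (fun x => 2 * Real.exp (-x) * hh n (2*x)) (show 3/4*x < x by linarith)
    (fun x _ => (hh_deriv n x).continuousAt.continuousWithinAt)
    (fun x _ => hh_deriv n x)
  have h0 : 0 ≤ hh (n+1) (3/4*x) := hh_nonneg _ (by linarith)
  rw [eq_div_iff (by linarith)] at h
  have h1 : hh n (3/2*x) ≤ hh n (2*c) :=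
    (hh_mono n).2 (by simp; linarith) (by simp; linarith [hc.1]) (by linarith [hc.1])
  have h2 : Real.exp (-x) ≤ Real.exp (-c) := Real.exp_le_exp.2 (by linarith [hc.2])
  have h3 := hh_nonneg n (show 0 ≤ 3/2*x by linarith)
  have h4 : Real.exp (-x) * hh n (3/2*x) ≤ Real.exp (-c) * hh n (2*c) :=
    mul_le_mul h2 h1 h3 (Real.exp_pos _).le
  have e : x - 3/4*x = x/4 := by ring
  rw [e] at h
  have h5 := mul_le_mul_of_nonneg_right h4 (show 0 ≤ x/4 by linarith)
  linarith

lemma choose_bound (j : ℕ) : ((2:ℝ)^(j.choose 2))⁻¹ ≤ 2 * (1/2)^j := by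
  have h : j ≤ j.choose 2 + 1 := by
    induction j with
    | zero => simp
    | succ k ih =>
      rw [Nat.choose_succ_succ' k 1]
      simp only [Nat.choose_one_right]
      rcases k with _ | k
      · simp
      · omega
  have h2 : (2:ℝ)^j ≤ 2^(j.choose 2 + 1) := pow_le_pow_right₀ (by norm_num) h
  rw [one_div, inv_pow, ← div_eq_mul_inv, inv_eq_one_div, div_le_div_iff₀ (by positivity) (by positivity)]
  rw [pow_succ] at h2
  linarith

lemma aa_bound (j : ℕ) : |aa j| ≤ 8 * (1/2)^j := by
  unfold aa
  rw [abs_div, abs_mul, abs_pow, abs_neg, abs_one, one_pow, one_mul, abs_of_pos (Q_pos j),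
    abs_of_pos (by positivity), div_le_iff₀ (Q_pos j)]
  have h0 : (0:ℝ) < (1/2)^j := by positivity
  nlinarith [choose_bound j, Q_ge j]

lemma term_bound (j : ℕ) {y r : ℝ} (hy : y ≤ 0) (hr : 1/4 ≤ r) :
    ‖aa j * Real.exp y / r‖ ≤ 32 * (1/2)^j := by
  have hr0 : 0 < r := by linarith
  rw [Real.norm_eq_abs, abs_div, abs_mul, abs_of_pos hr0, abs_of_pos (Real.exp_pos _), div_le_iff₀ hr0]
  have h1 : Real.exp y ≤ 1 := Real.exp_le_one_iff.2 hy
  have h2 := aa_bound j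
  have h0 : (0:ℝ) < (1/2)^j := by positivity
  have h3 : |aa j| * Real.exp y ≤ |aa j| := mul_le_of_le_one_right (abs_nonneg _) h1
  nlinarith

lemma bound_summable : Summable (fun j : ℕ => 32 * (1/2:ℝ)^j) :=
  (summable_geometric_of_lt_one (by norm_num) (by norm_num)).mul_left _

lemma F_eq (x : ℝ) : F x = ∑' j : ℕ, aa j * Real.exp (-(2:ℝ)^j * x) / Qinf := by
  unfold F aa
  congr 1
  ext j
  rw [div_mul_eq_mul_div, div_div]

lemma ff_tendsto {x : ℝ} (hx : 0 ≤ x) : Tendsto (fun n => ff n x) atTop (nhds (F x)) := by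
  have e : ∀ n, ff n x = ∑' j : ℕ, if j ∈ Finset.range (n+1) then
      aa j * Real.exp (-(2:ℝ)^j * x) / Q (n - j) else 0 := by
    intro n
    rw [tsum_eq_sum (s := Finset.range (n+1))]
    · unfold ff
      apply Finset.sum_congr rfl
      intro j hj
      rw [if_pos hj]
    · intro j hj
      rw [if_neg hj]
  simp_rw [e]
  rw [F_eq]
  apply tendsto_tsum_of_dominated_convergence bound_summable
  · intro j
    have h1 : Tendsto (fun n => aa j * Real.exp (-(2:ℝ)^j * x) / Q (n - j)) atTop
        (nhds (aa j * Real.exp (-(2:ℝ)^j * x) / Qinf)) :=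
      Tendsto.div tendsto_const_nhds (Q_tendsto.comp (tendsto_sub_atTop_nat j)) Qinf_pos.ne'
    refine h1.congr' ?_
    filter_upwards [eventually_ge_atTop j] with n hn
    rw [if_pos (by simp; omega)]
  · filter_upwards with n j
    split_ifs
    · apply term_bound j _ (Q_ge _)
      have : 0 ≤ (2:ℝ)^j * x := by positivity
      linarith
    · simp

lemma F_step {x : ℝ} (hx : 0 < x) :
    2 * Real.exp (-x) * (Real.exp (3/2*x) * F (3/2*x)) * (x/4) ≤ Real.exp x * F x := by
  have h1 : Tendsto (fun n => 2 * Real.exp (-x) * hh n (3/2*x) * (x/4)) atTop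
      (nhds (2 * Real.exp (-x) * (Real.exp (3/2*x) * F (3/2*x)) * (x/4))) :=
    (((ff_tendsto (by linarith)).const_mul _).const_mul _).mul_const _
  have h2 : Tendsto (fun n => hh (n+1) x) atTop (nhds (Real.exp x * F x)) :=
    (((ff_tendsto hx.le).const_mul _).comp (tendsto_add_atTop_nat 1))
  exact le_of_tendsto_of_tendsto' h1 h2 (fun n => hh_step n hx)

lemma F_large : ∀ᶠ x in atTop, 0 < F x := by
  have h : Tendsto (fun x : ℝ => ∑' j : ℕ, aa j * Real.exp (x + -(2:ℝ)^j * x) / Qinf) atTop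
      (nhds (∑' j : ℕ, if j = 0 then 1 / Qinf else 0)) := by
    apply tendsto_tsum_of_dominated_convergence bound_summable
    · intro j
      rcases j with _ | j
      · simp [aa, Q_zero]
      · simp only [Nat.add_eq_zero_iff, one_ne_zero, and_false, if_false]
        have h2 : (1:ℝ) < 2^(j+1) := one_lt_pow₀ (by norm_num) (by omega)
        have h1 : Tendsto (fun x : ℝ => x + -(2:ℝ)^(j+1) * x) atTop atBot := by
          have : (fun x : ℝ => x + -(2:ℝ)^(j+1) * x) = fun x => (1 - (2:ℝ)^(j+1)) * x := by
            ext x; ring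
          rw [this]
          exact tendsto_id.const_mul_atTop_of_neg (by linarith)
        have := ((Real.tendsto_exp_atBot.comp h1).const_mul (aa (j+1))).div_const Qinf
        simpa using this
    · filter_upwards [eventually_ge_atTop 0] with x hx j
      apply term_bound j _ Qinf_ge
      have h2 : (1:ℝ) ≤ 2^j := one_le_pow₀ (by norm_num)
      nlinarith
  rw [tsum_ite_eq] at h
  filter_upwards [h.eventually (lt_mem_nhds (show 0 < 1 / Qinf from one_div_pos.2 Qinf_pos))] with x hx
  have e : ∑' j : ℕ, aa j * Real.exp (x + -(2:ℝ)^j * x) / Qinf = Real.exp x * F x := by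
    rw [F_eq, ← tsum_mul_left]
    congr 1
    ext j
    rw [Real.exp_add]
    ring
  rw [e] at hx
  exact (pos_iff_pos_of_mul_pos hx).1 (Real.exp_pos x)

/-- `F(x) > 0` for every real `x > 0`. -/
theorem F_pos : ∀ x : ℝ, 0 < x → 0 < F x := by
  intro x hx
  by_contra hneg
  have hk : ∀ k : ℕ, ¬ 0 < F ((3/2)^k * x) := by
    intro k
    induction k with
    | zero => simpa using hneg
    | succ k ih =>
      intro hpos
      apply ih
      have hy : 0 < (3/2:ℝ)^k * x := by positivity
      have := F_step hy
      have e : 3/2 * ((3/2:ℝ)^k * x) = (3/2)^(k+1) * x := by ring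
      rw [e] at this
      have h2 : 0 < Real.exp ((3/2:ℝ)^k * x) * F ((3/2:ℝ)^k * x) :=
        lt_of_lt_of_le (by positivity) this
      exact (pos_iff_pos_of_mul_pos h2).1 (Real.exp_pos _)
  have ht : Tendsto (fun k : ℕ => (3/2:ℝ)^k * x) atTop atTop :=
    (tendsto_pow_atTop_atTop_of_one_lt (by norm_num)).atTop_mul_const hx
  obtain ⟨k, h⟩ := (ht.eventually F_large).exists
  exact hk k h
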